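/- arXiv:1901.07908 — 2 statements merged into one kernel-verified Lean document; each statement's English description precedes it below -/
import Mathlib

section
/- Let n > 9 be a positive integer with n ≡ 5 (mod 9). Then ∑_{k=0}^{n−1} (q^{−1};q^9)_k (q^{−1};q^9)_k (q^{−7};q^9)_k · q^{9k} / (q^9;q^9)_k^3 ≡ 0 (mod Φ_n(q)^2), as rational functions of q over ℚ. -/
open Finset Polynomial

/-- The q-shifted factorial `(x; q)_k = ∏_{j=0}^{k-1} (1 - x q^j)` in `RatFunc ℚ`. -/
noncomputable def qPoch (x q : RatFunc ℚ) (k : ℕ) : RatFunc ℚ :=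
  ∏ j ∈ Finset.range k, (1 - x * q ^ j)

/-- `A ≡ 0 (mod P)`: `A = P · B` for some rational function `B` whose denominator
(in lowest terms) is coprime to `P`. -/
def CongrZero (A : RatFunc ℚ) (P : Polynomial ℚ) : Prop :=
  ∃ B : RatFunc ℚ, A = algebraMap (Polynomial ℚ) (RatFunc ℚ) P * B ∧ IsCoprime B.denom P

theorem qPoch_zero (x Q : RatFunc ℚ) : qPoch x Q 0 = 1 := by
  simp [qPoch]

theorem qPoch_succ (x Q : RatFunc ℚ) (k : ℕ) :
    qPoch x Q (k + 1) = qPoch x Q k * (1 - x * Q ^ k) := by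
  simp [qPoch, prod_range_succ]

theorem qPoch_add (x Q : RatFunc ℚ) (m k : ℕ) :
    qPoch x Q (m + k) = qPoch x Q m * qPoch (x * Q ^ m) Q k := by
  simp only [qPoch, prod_range_add, pow_add, mul_assoc]

theorem qPoch_succ_left (x Q : RatFunc ℚ) (k : ℕ) :
    qPoch x Q (k + 1) = (1 - x) * qPoch (x * Q) Q k := by
  rw [add_comm, qPoch_add]
  simp [qPoch]

theorem qPoch_eq_zero {x Q : RatFunc ℚ} {M k : ℕ} (hx : x * Q ^ M = 1) (hk : M < k) :
    qPoch x Q k = 0 :=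
  prod_eq_zero (mem_range.2 hk) (by rw [hx, sub_self])

theorem qPoch_self_ne_zero {Q : RatFunc ℚ} (hQ : ∀ i : ℕ, Q ^ (i + 1) ≠ 1) (k : ℕ) :
    qPoch Q Q k ≠ 0 := by
  refine prod_ne_zero_iff.2 fun i _ h => hQ i ?_
  rw [pow_succ']
  exact (sub_eq_zero.1 h).symm

theorem sum_qPoch_div {Q : RatFunc ℚ} (hQ : ∀ i : ℕ, Q ^ (i + 1) ≠ 1) (x : RatFunc ℚ) (K : ℕ) :
    ∑ k ∈ range (K + 1), qPoch x Q k / qPoch Q Q k * Q ^ k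
      = qPoch (x * Q) Q K / qPoch Q Q K := by
  induction K with
  | zero => simp [qPoch_zero]
  | succ K ih =>
    have h0 := qPoch_self_ne_zero hQ K
    have h1 := qPoch_self_ne_zero hQ (K + 1)
    rw [sum_range_succ, ih, qPoch_succ_left x, qPoch_succ (x * Q)]
    rw [qPoch_succ] at h1 ⊢
    have h2 := right_ne_zero_of_mul h1
    field_simp
    ring

/-- The finite `q`-binomial theorem at the zeros of its right-hand side. -/
theorem sum_qPoch_div_mul_pow {Q : RatFunc ℚ} (hQ : ∀ i : ℕ, Q ^ (i + 1) ≠ 1)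
    {n : ℕ} (i : ℕ) : ∀ {M : ℕ} {x : RatFunc ℚ}, x * Q ^ M = 1 → i < M → M < n →
    ∑ k ∈ range n, qPoch x Q k / qPoch Q Q k * Q ^ k * (Q ^ k) ^ i = 0 := by
  induction i with
  | zero =>
    intro M x hx hM hn
    obtain ⟨K, rfl⟩ : ∃ K, n = K + 1 := ⟨n - 1, by omega⟩
    obtain ⟨L, rfl⟩ : ∃ L, M = L + 1 := ⟨M - 1, by omega⟩
    simp only [pow_zero, mul_one]
    rw [sum_qPoch_div hQ, qPoch_eq_zero (M := L) (by rw [← hx]; ring) (by omega), zero_div]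
  | succ i ih =>
    intro M x hx hM hn
    obtain ⟨L, rfl⟩ : ∃ L, M = L + 1 := ⟨M - 1, by omega⟩
    have hx0 : x ≠ 0 := left_ne_zero_of_mul_eq_one hx
    have h1 := ih hx (by omega) hn
    have h2 := ih (M := L) (x := x * Q) (by rw [← hx]; ring) (by omega) (by omega)
    have key : ∑ k ∈ range n, qPoch x Q k / qPoch Q Q k * Q ^ k * (Q ^ k) ^ (i + 1)
        = x⁻¹ * (∑ k ∈ range n, qPoch x Q k / qPoch Q Q k * Q ^ k * (Q ^ k) ^ i)
          - x⁻¹ * (1 - x) *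
            ∑ k ∈ range n, qPoch (x * Q) Q k / qPoch Q Q k * Q ^ k * (Q ^ k) ^ i := by
      rw [mul_sum, mul_sum, ← sum_sub_distrib]
      refine sum_congr rfl fun k _ => ?_
      have e := qPoch_succ_left x Q k
      rw [qPoch_succ] at e
      have e' : x⁻¹ * (1 - x) * (qPoch (x * Q) Q k / qPoch Q Q k * Q ^ k * (Q ^ k) ^ i)
          = x⁻¹ * ((qPoch x Q k * (1 - x * Q ^ k)) / qPoch Q Q k * Q ^ k * (Q ^ k) ^ i) := by
        rw [e]; ring
      rw [e']
      have hxx : x⁻¹ * x = 1 := inv_mul_cancel₀ hx0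
      linear_combination (-(qPoch x Q k / qPoch Q Q k * Q ^ k * (Q ^ k) ^ i * Q ^ k)) * hxx
    rw [key, h1, h2]
    simp

theorem sum_qPoch_div_mul_eval {Q : RatFunc ℚ} (hQ : ∀ i : ℕ, Q ^ (i + 1) ≠ 1)
    {n M : ℕ} {x : RatFunc ℚ} (hx : x * Q ^ M = 1) (hM : M < n) (p : (RatFunc ℚ)[X])
    (hp : p.natDegree < M) :
    ∑ k ∈ range n, qPoch x Q k / qPoch Q Q k * Q ^ k * p.eval (Q ^ k) = 0 := by
  simp only [eval_eq_sum_range, mul_sum]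
  rw [sum_comm]
  refine sum_eq_zero fun i hi => ?_
  have h := sum_qPoch_div_mul_pow hQ i hx (by have := mem_range.1 hi; omega) hM
  calc _ = p.coeff i * ∑ k ∈ range n, qPoch x Q k / qPoch Q Q k * Q ^ k * (Q ^ k) ^ i := by
        rw [mul_sum]
        exact sum_congr rfl fun k _ => by ring
    _ = 0 := by rw [h, mul_zero]

theorem exists_eval_eq_qPoch_div {Q : RatFunc ℚ} (hQ : ∀ i : ℕ, Q ^ (i + 1) ≠ 1) (m : ℕ) :
    ∃ p : (RatFunc ℚ)[X], p.natDegree ≤ m ∧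
      ∀ k, qPoch (Q ^ (m + 1)) Q k / qPoch Q Q k = p.eval (Q ^ k) := by
  refine ⟨C (qPoch Q Q m)⁻¹ * ∏ i ∈ range m, (1 - C (Q ^ (i + 1)) * X), ?_, fun k => ?_⟩
  · refine (natDegree_C_mul_le _ _).trans ((natDegree_prod_le _ _).trans ?_)
    refine (sum_le_card_nsmul _ _ 1 fun i _ => ?_).trans (by simp)
    compute_degree
  · have e := qPoch_add Q Q m k
    rw [add_comm m k, qPoch_add Q Q k m] at e
    have h1 := qPoch_self_ne_zero hQ k
    have h2 := qPoch_self_ne_zero hQ m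
    have e2 : qPoch (Q * Q ^ k) Q m = ∏ i ∈ range m, (1 - Q ^ (i + 1) * Q ^ k) :=
      prod_congr rfl fun i _ => by ring
    rw [eval_mul, eval_C, eval_prod]
    simp only [eval_sub, eval_one, eval_mul, eval_C, eval_X]
    rw [← e2, pow_succ', inv_mul_eq_div, div_eq_div_iff h1 h2]
    linear_combination -e

/-- A `q`-analogue of the Karlsson–Minton vanishing sum. -/
theorem sum_qPoch_mul_qPoch_mul_qPoch_eq_zero {Q : RatFunc ℚ}
    (hQ : ∀ i : ℕ, Q ^ (i + 1) ≠ 1) {n M m₁ m₂ : ℕ} {x : RatFunc ℚ} (hx : x * Q ^ M = 1)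
    (hM : M < n) (hm : m₁ + m₂ < M) :
    ∑ k ∈ range n, qPoch (Q ^ (m₁ + 1)) Q k * qPoch (Q ^ (m₂ + 1)) Q k * qPoch x Q k
      * (Q ^ k / qPoch Q Q k ^ 3) = 0 := by
  obtain ⟨p₁, hp₁, h₁⟩ := exists_eval_eq_qPoch_div hQ m₁
  obtain ⟨p₂, hp₂, h₂⟩ := exists_eval_eq_qPoch_div hQ m₂
  rw [← sum_qPoch_div_mul_eval hQ hx hM (p₁ * p₂)
    (natDegree_mul_le.trans_lt (by omega))]
  refine sum_congr rfl fun k _ => ?_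
  rw [eval_mul, ← h₁, ← h₂]
  ring

theorem exists_zpow_eq_one_add {K : Type*} [Field K] (V : Subring K) {u : K} (hu0 : u ≠ 0)
    (hu : u ∈ V) (hu' : u⁻¹ ∈ V) (a : ℤ) :
    ∃ w ∈ V, u ^ a = 1 + a * (u - 1) + (u - 1) ^ 2 * w := by
  induction a using Int.induction_on with
  | zero => exact ⟨0, V.zero_mem, by simp⟩
  | succ a ih =>
    obtain ⟨w, hw, h⟩ := ih
    refine ⟨a + w * u, V.add_mem (natCast_mem V a) (V.mul_mem hw hu), ?_⟩
    rw [zpow_add_one₀ hu0, h]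
    push_cast
    ring
  | pred a ih =>
    obtain ⟨w, hw, h⟩ := ih
    refine ⟨(w + a + 1) * u⁻¹,
      V.mul_mem (V.add_mem (V.add_mem hw (natCast_mem V a)) V.one_mem) hu', ?_⟩
    rw [zpow_sub_one₀ hu0, h]
    push_cast
    field_simp
    ring

theorem qPoch_mem (V : Subring (RatFunc ℚ)) {x Q : RatFunc ℚ} (hx : x ∈ V) (hQ : Q ∈ V) (k : ℕ) :
    qPoch x Q k ∈ V :=
  V.prod_mem fun _ _ => V.sub_mem V.one_mem (V.mul_mem hx (V.pow_mem hQ _))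

theorem exists_qPoch_mul_zpow_eq (V : Subring (RatFunc ℚ)) {u x Q : RatFunc ℚ} (hu0 : u ≠ 0)
    (hu : u ∈ V) (hu' : u⁻¹ ∈ V) (hx : x ∈ V) (hQ : Q ∈ V) (k : ℕ) :
    ∃ D ∈ V, ∀ a : ℤ, ∃ v ∈ V,
      qPoch (x * u ^ a) Q k = qPoch x Q k + a * (u - 1) * D + (u - 1) ^ 2 * v := by
  induction k with
  | zero => exact ⟨0, V.zero_mem, fun a => ⟨0, V.zero_mem, by simp [qPoch_zero]⟩⟩
  | succ k ih =>
    obtain ⟨D, hD, h⟩ := ih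
    have hp := qPoch_mem V hx hQ k
    have hy : x * Q ^ k ∈ V := V.mul_mem hx (V.pow_mem hQ k)
    refine ⟨D * (1 - x * Q ^ k) - qPoch x Q k * (x * Q ^ k),
      V.sub_mem (V.mul_mem hD (V.sub_mem V.one_mem hy)) (V.mul_mem hp hy), fun a => ?_⟩
    obtain ⟨v, hv, e⟩ := h a
    obtain ⟨w, hw, e'⟩ := exists_zpow_eq_one_add V hu0 hu hu' a
    have hz : x * u ^ a * Q ^ k ∈ V := by
      rw [mul_right_comm, e']
      exact V.mul_mem hy (V.add_mem (V.add_mem V.one_mem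
        (V.mul_mem (intCast_mem V a) (V.sub_mem hu V.one_mem)))
        (V.mul_mem (V.pow_mem (V.sub_mem hu V.one_mem) 2) hw))
    refine ⟨v * (1 - x * u ^ a * Q ^ k) - qPoch x Q k * (x * Q ^ k) * w
      - a * D * (x * Q ^ k) * (a + (u - 1) * w), ?_, ?_⟩
    · exact V.sub_mem (V.sub_mem (V.mul_mem hv (V.sub_mem V.one_mem hz))
        (V.mul_mem (V.mul_mem hp hy) hw)) (V.mul_mem (V.mul_mem (V.mul_mem (intCast_mem V a) hD) hy)
        (V.add_mem (intCast_mem V a) (V.mul_mem (V.sub_mem hu V.one_mem) hw)))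
    · rw [qPoch_succ, qPoch_succ, e, e']
      ring

/-- To second order in `u - 1`, the sum depends on the exponents `a`, `b`, `c` affinely, with the
same slope in `a` and `b`. -/
theorem exists_sum_qPoch_mul_zpow_eq (V : Subring (RatFunc ℚ)) {u x y Q : RatFunc ℚ} (hu0 : u ≠ 0)
    (hu : u ∈ V) (hu' : u⁻¹ ∈ V) (hx : x ∈ V) (hy : y ∈ V) (hQ : Q ∈ V) (s : Finset ℕ)
    (f : ℕ → RatFunc ℚ) (hf : ∀ k ∈ s, f k ∈ V) :
    ∃ G H : RatFunc ℚ, ∀ a b c : ℤ, ∃ v ∈ V,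
      ∑ k ∈ s, qPoch (x * u ^ a) Q k * qPoch (x * u ^ b) Q k * qPoch (y * u ^ c) Q k * f k
        = ∑ k ∈ s, qPoch x Q k * qPoch x Q k * qPoch y Q k * f k
          + (a + b) * (u - 1) * G + c * (u - 1) * H + (u - 1) ^ 2 * v := by
  induction s using Finset.induction_on with
  | empty => exact ⟨0, 0, fun a b c => ⟨0, V.zero_mem, by simp⟩⟩
  | insert k s hk ih =>
    obtain ⟨G, H, h⟩ := ih fun i hi => hf i (mem_insert_of_mem hi)
    obtain ⟨D, hD, hxD⟩ := exists_qPoch_mul_zpow_eq V hu0 hu hu' hx hQ k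
    obtain ⟨E, hE, hyE⟩ := exists_qPoch_mul_zpow_eq V hu0 hu hu' hy hQ k
    have hfk := hf k (mem_insert_self k s)
    have hA := qPoch_mem V hx hQ k
    have hB := qPoch_mem V hy hQ k
    refine ⟨G + qPoch x Q k * D * qPoch y Q k * f k, H + qPoch x Q k * qPoch x Q k * E * f k,
      fun a b c => ?_⟩
    obtain ⟨v, hv, e⟩ := h a b c
    obtain ⟨v₁, hv₁, e₁⟩ := hxD a
    obtain ⟨v₂, hv₂, e₂⟩ := hxD b
    obtain ⟨v₃, hv₃, e₃⟩ := hyE c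
    have ha := intCast_mem V a
    have hb := intCast_mem V b
    have hc := intCast_mem V c
    have hε : u - 1 ∈ V := V.sub_mem hu V.one_mem
    rw [sum_insert hk, sum_insert hk, e, e₁, e₂, e₃]
    generalize qPoch x Q k = A at *
    generalize qPoch y Q k = B at *
    refine ⟨v + (A * v₁ * B + A * v₂ * B + A * A * v₃ + a * b * D * D * B
      + (a + b) * c * A * D * E + (u - 1) * (A * c * E * (v₁ + v₂) + (a + b) * D * A * v₃
        + (a * D * v₂ + b * D * v₁) * B + a * b * c * D * D * E
        + (u - 1) * (A * (v₁ + v₂) * v₃ + a * b * D * D * v₃ + (a * D * v₂ + b * D * v₁) * c * E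
          + v₁ * v₂ * B + (u - 1) * ((a * D * v₂ + b * D * v₁) * v₃ + v₁ * v₂ * c * E
            + (u - 1) * (v₁ * v₂ * v₃))))) * f k, ?_, ?_⟩
    · repeat' first | assumption | apply V.add_mem | apply V.mul_mem
    · ring

/-- The rational functions over `ℚ` whose denominator is coprime to `P`. -/
def coprimeDenom (P : ℚ[X]) : Subring (RatFunc ℚ) where
  carrier := {A | IsCoprime A.denom P}
  mul_mem' ha hb := (IsCoprime.mul_left ha hb).of_isCoprime_of_dvd_left (RatFunc.denom_mul_dvd _ _)
  one_mem' := by simp [isCoprime_one_left]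
  add_mem' ha hb := (IsCoprime.mul_left ha hb).of_isCoprime_of_dvd_left (RatFunc.denom_add_dvd _ _)
  zero_mem' := by simp [isCoprime_one_left]
  neg_mem' {x} ha := by
    have h := RatFunc.denom_mul_dvd (algebraMap ℚ[X] (RatFunc ℚ) (-1)) x
    rw [RatFunc.denom_algebraMap, one_mul, map_neg, map_one, neg_one_mul] at h
    exact IsCoprime.of_isCoprime_of_dvd_left ha h

theorem algebraMap_mem_coprimeDenom (P p : ℚ[X]) :
    algebraMap ℚ[X] (RatFunc ℚ) p ∈ coprimeDenom P := by
  change IsCoprime _ _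
  rw [RatFunc.denom_algebraMap]
  exact isCoprime_one_left

theorem inv_algebraMap_mem_coprimeDenom {P p : ℚ[X]} (h : IsCoprime p P) :
    (algebraMap ℚ[X] (RatFunc ℚ) p)⁻¹ ∈ coprimeDenom P := by
  have h' := RatFunc.denom_div_dvd 1 p
  rw [map_one, one_div] at h'
  exact h.of_isCoprime_of_dvd_left h'

theorem isCoprime_cyclotomic {n : ℕ} (hn : 0 < n) {p : ℚ[X]}
    (h : ¬ cyclotomic n ℚ ∣ p) : IsCoprime p (cyclotomic n ℚ) :=
  ((cyclotomic.irreducible_rat hn).coprime_iff_not_dvd.2 h).symm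

theorem dvd_of_cyclotomic_dvd {n m : ℕ} (hn : n ≠ 0) (h : cyclotomic n ℚ ∣ 1 - X ^ m) : n ∣ m := by
  have hζ := Complex.isPrimitiveRoot_exp n hn
  set ζ := Complex.exp (2 * Real.pi * Complex.I / n)
  have h0 : aeval ζ (cyclotomic n ℚ) = 0 := by
    rw [cyclotomic_eq_minpoly_rat hζ (Nat.pos_of_ne_zero hn)]
    exact minpoly.aeval _ _
  have h1 := aeval_eq_zero_of_dvd_aeval_eq_zero h h0
  simp only [map_sub, map_one, map_pow, aeval_X] at h1
  exact hζ.dvd_of_pow_eq_one m (sub_eq_zero.1 h1).symm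

theorem ratFunc_X_pow_succ_ne_one (i : ℕ) : (RatFunc.X : RatFunc ℚ) ^ (i + 1) ≠ 1 := by
  rw [← RatFunc.algebraMap_X, ← map_pow, ← map_one (algebraMap ℚ[X] (RatFunc ℚ))]
  intro h
  have := congrArg natDegree (RatFunc.algebraMap_injective ℚ h)
  simp at this

theorem stmt15 (n : ℕ) (hn : 0 < n) (hn9 : 9 < n) (hmod : n % 9 = 5) :
    CongrZero
      (∑ k ∈ Finset.range n,
        qPoch ((RatFunc.X : RatFunc ℚ) ^ ((-1) : ℤ)) (RatFunc.X ^ 9) k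
            * qPoch ((RatFunc.X : RatFunc ℚ) ^ ((-1) : ℤ)) (RatFunc.X ^ 9) k
            * qPoch ((RatFunc.X : RatFunc ℚ) ^ ((-7) : ℤ)) (RatFunc.X ^ 9) k
            * RatFunc.X ^ (9 * k)
          / (qPoch ((RatFunc.X : RatFunc ℚ) ^ 9) (RatFunc.X ^ 9) k) ^ 3)
      ((Polynomial.cyclotomic n ℚ) ^ 2) := by
  set q : RatFunc ℚ := RatFunc.X with hq
  set V := coprimeDenom (cyclotomic n ℚ ^ 2)
  have hq0 : q ≠ 0 := RatFunc.X_ne_zero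
  have hqV : q ∈ V := by
    rw [hq, ← RatFunc.algebraMap_X]
    exact algebraMap_mem_coprimeDenom _ _
  have hq' : q⁻¹ ∈ V := by
    rw [hq, ← RatFunc.algebraMap_X]
    refine inv_algebraMap_mem_coprimeDenom
      (IsCoprime.pow_right (isCoprime_cyclotomic hn fun h => ?_))
    have h1 : cyclotomic n ℚ ∣ X ^ n := h.trans (dvd_pow_self X hn.ne')
    have h2 := dvd_sub h1 (cyclotomic.dvd_X_pow_sub_one n ℚ)
    rw [sub_sub_cancel] at h2
    exact (cyclotomic.irreducible_rat hn).not_isUnit (isUnit_of_dvd_one h2)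
  have hinv : ∀ i, i + 1 < n → (1 - q ^ 9 * (q ^ 9) ^ i)⁻¹ ∈ V := by
    intro i hi
    have e : 1 - q ^ 9 * (q ^ 9) ^ i = algebraMap ℚ[X] (RatFunc ℚ) (1 - X ^ (9 * (i + 1))) := by
      rw [map_sub, map_one, map_pow, RatFunc.algebraMap_X]
      ring
    have hnd : ¬ cyclotomic n ℚ ∣ 1 - X ^ (9 * (i + 1)) := fun h => by
      have h9 : Nat.Coprime n 9 := by
        rw [Nat.Coprime, Nat.gcd_comm, Nat.gcd_rec, hmod]
        rfl
      exact Nat.not_dvd_of_pos_of_lt i.succ_pos hi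
        (h9.dvd_of_dvd_mul_left (dvd_of_cyclotomic_dvd hn.ne' h))
    rw [e]
    exact inv_algebraMap_mem_coprimeDenom (IsCoprime.pow_right (isCoprime_cyclotomic hn hnd))
  have hQV : q ^ 9 ∈ V := V.pow_mem hqV 9
  have hQ : ∀ i : ℕ, (q ^ 9) ^ (i + 1) ≠ 1 := fun i => by
    rw [← pow_mul]
    exact ratFunc_X_pow_succ_ne_one (9 * i + 8)
  have hf : ∀ k ∈ range n, (q ^ 9) ^ k / qPoch (q ^ 9) (q ^ 9) k ^ 3 ∈ V := by
    intro k hk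
    rw [div_eq_mul_inv, ← inv_pow, qPoch, ← prod_inv_distrib]
    refine V.mul_mem (V.pow_mem hQV k) (V.pow_mem (V.prod_mem fun i hi => hinv i ?_) 3)
    have := mem_range.1 hi
    have := mem_range.1 hk
    omega
  obtain ⟨G, H, h⟩ := exists_sum_qPoch_mul_zpow_eq V (u := q ^ n) (x := q ^ (-1 : ℤ))
    (y := q ^ (-7 : ℤ)) (pow_ne_zero n hq0) (V.pow_mem hqV n)
    (by rw [← inv_pow]; exact V.pow_mem hq' n)
    (by rw [zpow_neg_one]; exact hq')
    (by rw [show (-7 : ℤ) = -((7 : ℕ) : ℤ) from rfl, zpow_neg, zpow_natCast, ← inv_pow]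
        exact V.pow_mem hq' 7) hQV (range n) _ hf
  obtain ⟨j, rfl⟩ : ∃ j, n = 9 * j + 5 := ⟨n / 9, by omega⟩
  have hpos : ∀ (r a : ℤ) (m : ℕ), r + (9 * j + 5) * a = 9 * (m + 1) →
      q ^ r * (q ^ (9 * j + 5)) ^ a = (q ^ 9) ^ (m + 1) := by
    intro r a m e
    rw [← pow_mul, ← zpow_natCast, ← zpow_natCast, ← zpow_mul, ← zpow_add₀ hq0]
    exact congrArg (q ^ ·) e
  have hneg : ∀ (r a : ℤ) (m : ℕ), r + (9 * j + 5) * a = -(9 * m) →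
      q ^ r * (q ^ (9 * j + 5)) ^ a * (q ^ 9) ^ m = 1 := by
    intro r a m e
    rw [← pow_mul, ← zpow_natCast, ← zpow_natCast, ← zpow_mul, ← zpow_add₀ hq0, ← zpow_add₀ hq0,
      ← zpow_zero q]
    congr 1
    push_cast
    linarith
  have s₁ := sum_qPoch_mul_qPoch_mul_qPoch_eq_zero hQ (n := 9 * j + 5) (m₁ := 2 * j)
    (m₂ := 2 * j) (hneg (-7) (-4) (4 * j + 3) (by push_cast; ring)) (by omega) (by omega)
  have s₂ := sum_qPoch_mul_qPoch_mul_qPoch_eq_zero hQ (n := 9 * j + 5) (m₁ := 2 * j)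
    (m₂ := 5 * j + 1) (hneg (-1) (-7) (7 * j + 4) (by push_cast; ring)) (by omega) (by omega)
  obtain ⟨v₁, hv₁, e₁⟩ := h 2 2 (-4)
  obtain ⟨v₂, hv₂, e₂⟩ := h 2 (-7) 5
  rw [hpos (-1) 2 (2 * j) (by push_cast; ring), s₁] at e₁
  rw [hpos (-1) 2 (2 * j) (by push_cast; ring), hpos (-7) 5 (5 * j + 1) (by push_cast; ring)] at e₂
  simp only [mul_right_comm _ (qPoch (q ^ (-1 : ℤ) * _) _ _) (qPoch _ _ _)] at e₂
  rw [s₂] at e₂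
  obtain ⟨c, hc⟩ := cyclotomic.dvd_X_pow_sub_one (9 * j + 5) ℚ
  have hε : q ^ (9 * j + 5) - 1 = algebraMap ℚ[X] (RatFunc ℚ) (cyclotomic (9 * j + 5) ℚ)
      * algebraMap ℚ[X] (RatFunc ℚ) c := by
    rw [← map_mul, ← hc, map_sub, map_pow, map_one, RatFunc.algebraMap_X]
  have h9 : (9 : RatFunc ℚ)⁻¹ ∈ V := by
    have := algebraMap_mem_coprimeDenom (cyclotomic (9 * j + 5) ℚ ^ 2) (C (9 : ℚ)⁻¹)
    rw [RatFunc.algebraMap_C, map_inv₀, map_ofNat] at this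
    exact this
  refine ⟨-((9 : RatFunc ℚ)⁻¹ * algebraMap ℚ[X] (RatFunc ℚ) c ^ 2 * (5 * v₁ + 4 * v₂)), ?_, ?_⟩
  · have e : ∀ k, qPoch (q ^ (-1 : ℤ)) (q ^ 9) k * qPoch (q ^ (-1 : ℤ)) (q ^ 9) k
        * qPoch (q ^ (-7 : ℤ)) (q ^ 9) k * q ^ (9 * k) / qPoch (q ^ 9) (q ^ 9) k ^ 3
        = qPoch (q ^ (-1 : ℤ)) (q ^ 9) k * qPoch (q ^ (-1 : ℤ)) (q ^ 9) k
        * qPoch (q ^ (-7 : ℤ)) (q ^ 9) k * ((q ^ 9) ^ k / qPoch (q ^ 9) (q ^ 9) k ^ 3) :=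
      fun k => by rw [pow_mul, mul_div_assoc]
    simp only [e]
    rw [hε] at e₁ e₂
    push_cast at e₁ e₂
    rw [map_pow]
    linear_combination (-5 / 9) * e₁ - 4 / 9 * e₂
  · exact V.neg_mem (V.mul_mem (V.mul_mem h9 (V.pow_mem (algebraMap_mem_coprimeDenom _ _) 2))
      (V.add_mem (V.mul_mem (ofNat_mem V 5) hv₁) (V.mul_mem (ofNat_mem V 4) hv₂)))
end

section
/- Let n > 9 be a positive integer with n ≡ 2 (mod 9) or n ≡ 5 (mod 9). Then ∑_{k=0}^{n−1} (q^{−2};q^9)_k (q^{−2};q^9)_k (q^{−5};q^9)_k · q^{9k} / (q^9;q^9)_k^3 ≡ 0 (mod Φ_n(q)^2), as rational functions of q over ℚ. -/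
open Finset Polynomial

section CommRing

variable {R : Type*} [CommRing R]

/-- The `q`-shifted factorial `(x; p)_k` over a commutative ring. -/
def shiftedFactorial (x p : R) (k : ℕ) : R :=
  ∏ j ∈ range k, (1 - x * p ^ j)

/-- The sum of `(x, y, z; p)_k p ^ k / (p; p)_k ^ 3` over `k < n`. -/
noncomputable def truncatedSeries (p : R) (n : ℕ) (x y z : R) : R :=
  ∑ k ∈ range n, shiftedFactorial x p k * shiftedFactorial y p k * shiftedFactorial z p k
    * p ^ k * Ring.inverse (shiftedFactorial p p k) ^ 3

theorem shiftedFactorial_succ (x p : R) (k : ℕ) :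
    shiftedFactorial x p (k + 1) = shiftedFactorial x p k * (1 - x * p ^ k) :=
  prod_range_succ _ _

theorem isUnit_shiftedFactorial_self {p : R} {n : ℕ}
    (hp : ∀ k, 0 < k → k < n → IsUnit (1 - p ^ k)) {k : ℕ} (hk : k < n) :
    IsUnit (shiftedFactorial p p k) := by
  induction k with
  | zero => simp [shiftedFactorial]
  | succ k ih =>
    rw [shiftedFactorial_succ, ← pow_succ']
    exact (ih (by omega)).mul (hp _ (by omega) hk)

theorem shiftedFactorial_pow_mul (p : R) (a b : ℕ) :
    shiftedFactorial p p a * shiftedFactorial (p ^ (a + 1)) p b = shiftedFactorial p p (a + b) := by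
  induction b with
  | zero => simp [shiftedFactorial]
  | succ b ih =>
    rw [shiftedFactorial_succ, ← mul_assoc, ih, ← add_assoc, shiftedFactorial_succ]
    ring

/-- Truncated form of the functional equation behind the `q`-binomial theorem. -/
theorem sum_functional_equation (p x z : R) (c : ℕ → R) (l : ℕ)
    (hc : ∀ k < l, c (k + 1) * (1 - p ^ (k + 1)) = c k * (1 - x * p ^ k)) :
    (1 - z) * ∑ k ∈ range (l + 1), c k * z ^ k
      = (1 - x * z) * ∑ k ∈ range (l + 1), c k * (p * z) ^ k
        - c l * (1 - x * p ^ l) * z ^ (l + 1) := by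
  induction l with
  | zero => simp; ring
  | succ l ih =>
    rw [sum_range_succ, sum_range_succ _ (l + 1), mul_add, mul_add,
      ih fun k hk => hc k (by omega), mul_pow]
    linear_combination z ^ (l + 1) * hc l (by omega)

theorem sum_pow_eq_zero {p x : R} {n N : ℕ}
    (hp : ∀ k, 0 < k → k < n → IsUnit (1 - p ^ k)) (hx : x * p ^ N = 1) (hN : N < n)
    (i : ℕ) (hi : i < N) :
    ∑ k ∈ range n, shiftedFactorial x p k * Ring.inverse (shiftedFactorial p p k)
      * (p ^ (i + 1)) ^ k = 0 := by
  obtain ⟨l, rfl⟩ : ∃ l, n = l + 1 := ⟨n - 1, by omega⟩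
  set c : ℕ → R :=
    fun k => shiftedFactorial x p k * Ring.inverse (shiftedFactorial p p k) with hc_def
  have hp_unit : IsUnit p := by
    have : IsUnit (p ^ N) := IsUnit.of_mul_eq_one_right x hx
    exact (isUnit_pow_iff (by omega)).1 this
  have hx_unit : IsUnit x := IsUnit.of_mul_eq_one _ hx
  have hc : ∀ k < l, c (k + 1) * (1 - p ^ (k + 1)) = c k * (1 - x * p ^ k) := by
    intro k hk
    have h1 := Ring.inverse_mul_cancel _ (isUnit_shiftedFactorial_self hp (k := k) (by omega))
    have h2 := Ring.mul_inverse_cancel _ (isUnit_shiftedFactorial_self hp (k := k + 1) (by omega))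
    simp only [hc_def]
    rw [shiftedFactorial_succ p p, ← pow_succ'] at h2 ⊢
    rw [shiftedFactorial_succ]
    set u := Ring.inverse (shiftedFactorial p p k)
    set v := Ring.inverse (shiftedFactorial p p k * (1 - p ^ (k + 1)))
    have h3 : v * (1 - p ^ (k + 1)) = u := by
      linear_combination (-v * (1 - p ^ (k + 1))) * h1 + u * h2
    linear_combination (shiftedFactorial x p k * (1 - x * p ^ k)) * h3
  have hlast : c l * (1 - x * p ^ l) = 0 := by
    have : shiftedFactorial x p (l + 1) = 0 :=
      prod_eq_zero (mem_range.2 hN) (by rw [hx, sub_self])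
    rw [shiftedFactorial_succ] at this
    simp only [hc_def]
    linear_combination Ring.inverse (shiftedFactorial p p l) * this
  have hrec (i : ℕ) (hi : i < N)
      (h : (1 - p ^ i) * ∑ k ∈ range (l + 1), c k * (p ^ i) ^ k = 0) :
      ∑ k ∈ range (l + 1), c k * (p ^ (i + 1)) ^ k = 0 := by
    rw [sum_functional_equation p x _ c l hc, hlast, zero_mul, sub_zero, ← pow_succ'] at h
    have hu : IsUnit (1 - x * p ^ i) := by
      have : 1 - x * p ^ i = -(x * p ^ i * (1 - p ^ (N - i))) := by
        have : p ^ N = p ^ i * p ^ (N - i) := by rw [← pow_add]; congr 1; omega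
        rw [this] at hx
        linear_combination -hx
      rw [this]
      exact ((hx_unit.mul (hp_unit.pow i)).mul (hp _ (by omega) (by omega))).neg
    exact hu.mul_right_eq_zero.1 h
  induction i with
  | zero => exact hrec 0 hi (by simp)
  | succ i ih => exact hrec (i + 1) hi (by rw [ih (by omega), mul_zero])

theorem sum_polynomial_eq_zero {p x : R} {n N : ℕ}
    (hp : ∀ k, 0 < k → k < n → IsUnit (1 - p ^ k)) (hx : x * p ^ N = 1) (hN : N < n)
    (g : R[X]) (hg : g.natDegree < N) :
    ∑ k ∈ range n, shiftedFactorial x p k * Ring.inverse (shiftedFactorial p p k)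
      * p ^ k * g.eval (p ^ k) = 0 := by
  simp_rw [eval_eq_sum_range, mul_sum]
  rw [sum_comm]
  refine sum_eq_zero fun i hi => ?_
  have := sum_pow_eq_zero hp hx hN i (by rw [mem_range] at hi; omega)
  rw [← mul_zero (g.coeff i), ← this, mul_sum]
  refine sum_congr rfl fun k _ => ?_
  ring

theorem shiftedFactorial_pow_mul_inverse {p : R} {n : ℕ}
    (hp : ∀ k, 0 < k → k < n → IsUnit (1 - p ^ k)) {m k : ℕ} (hm : m < n) (hk : k < n) :
    shiftedFactorial (p ^ (m + 1)) p k * Ring.inverse (shiftedFactorial p p k)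
      = Ring.inverse (shiftedFactorial p p m) * shiftedFactorial (p ^ (k + 1)) p m := by
  have hu := Ring.mul_inverse_cancel _ (isUnit_shiftedFactorial_self hp hm)
  have hv := Ring.mul_inverse_cancel _ (isUnit_shiftedFactorial_self hp hk)
  have h : shiftedFactorial p p m * shiftedFactorial (p ^ (m + 1)) p k
      = shiftedFactorial p p k * shiftedFactorial (p ^ (k + 1)) p m := by
    rw [shiftedFactorial_pow_mul, shiftedFactorial_pow_mul, add_comm]
  set a := Ring.inverse (shiftedFactorial p p m)
  set b := Ring.inverse (shiftedFactorial p p k)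
  linear_combination (a * b) * h - (shiftedFactorial (p ^ (m + 1)) p k * b) * hu
    + (a * shiftedFactorial (p ^ (k + 1)) p m) * hv

/-- `(p ^ (k + 1); p)_m` as a polynomial in `p ^ k`. -/
theorem exists_polynomial_shiftedFactorial (p : R) (m : ℕ) :
    ∃ g : R[X], g.natDegree ≤ m ∧
      ∀ k : ℕ, shiftedFactorial (p ^ (k + 1)) p m = g.eval (p ^ k) := by
  refine ⟨∏ j ∈ range m, (1 - C (p ^ (j + 1)) * Polynomial.X), ?_, fun k => ?_⟩
  · refine (natDegree_prod_le _ _).trans ?_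
    refine (sum_le_card_nsmul _ _ 1 fun j _ => ?_).trans (by simp)
    compute_degree
  · rw [eval_prod]
    refine prod_congr rfl fun j _ => ?_
    simp
    ring

theorem truncatedSeries_eq_zero {p x : R} {n N m₁ m₂ : ℕ}
    (hp : ∀ k, 0 < k → k < n → IsUnit (1 - p ^ k)) (hx : x * p ^ N = 1) (hN : N < n)
    (hm₁ : m₁ < n) (hm₂ : m₂ < n) (hm : m₁ + m₂ < N) :
    truncatedSeries p n x (p ^ (m₁ + 1)) (p ^ (m₂ + 1)) = 0 := by
  obtain ⟨g₁, hd₁, hg₁⟩ := exists_polynomial_shiftedFactorial p m₁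
  obtain ⟨g₂, hd₂, hg₂⟩ := exists_polynomial_shiftedFactorial p m₂
  have h := sum_polynomial_eq_zero hp hx hN (g₁ * g₂) (natDegree_mul_le.trans_lt (by omega))
  rw [← mul_zero (Ring.inverse (shiftedFactorial p p m₁) * Ring.inverse (shiftedFactorial p p m₂)),
    ← h, truncatedSeries, mul_sum]
  refine sum_congr rfl fun k hk => ?_
  have h₁ := shiftedFactorial_pow_mul_inverse hp hm₁ (mem_range.1 hk)
  have h₂ := shiftedFactorial_pow_mul_inverse hp hm₂ (mem_range.1 hk)
  rw [hg₁] at h₁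
  rw [hg₂] at h₂
  rw [eval_mul]
  set v := Ring.inverse (shiftedFactorial p p k)
  linear_combination (shiftedFactorial x p k * v * p ^ k) *
    (shiftedFactorial (p ^ (m₂ + 1)) p k * v * h₁
      + Ring.inverse (shiftedFactorial p p m₁) * g₁.eval (p ^ k) * h₂)

theorem truncatedSeries_swap_left (p : R) (n : ℕ) (x y z : R) :
    truncatedSeries p n y x z = truncatedSeries p n x y z :=
  sum_congr rfl fun k _ => by ring

theorem truncatedSeries_rotate (p : R) (n : ℕ) (x y z : R) :
    truncatedSeries p n z x y = truncatedSeries p n x y z :=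
  sum_congr rfl fun k _ => by ring

theorem exists_shiftedFactorial_affine {ε : R} (hε : ε ^ 2 = 0) (p x : R) (k : ℕ) :
    ∃ d : R, ∀ s : R,
      shiftedFactorial (x * (1 + s * ε)) p k = shiftedFactorial x p k + s * ε * d := by
  induction k with
  | zero => exact ⟨0, fun s => by simp [shiftedFactorial]⟩
  | succ k ih =>
    obtain ⟨d, hd⟩ := ih
    refine ⟨d * (1 - x * p ^ k) - shiftedFactorial x p k * (x * p ^ k), fun s => ?_⟩
    rw [shiftedFactorial_succ, shiftedFactorial_succ, hd]
    linear_combination (-s ^ 2 * d * x * p ^ k) * hε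

theorem exists_truncatedSeries_affine {ε : R} (hε : ε ^ 2 = 0) (p : R) (n : ℕ) (x y z : R) :
    ∃ a b c d : R, ∀ s t u : R,
      truncatedSeries p n (x * (1 + s * ε)) (y * (1 + t * ε)) (z * (1 + u * ε))
        = a + s * b + t * c + u * d := by
  choose f hf using exists_shiftedFactorial_affine hε p x
  choose g hg using exists_shiftedFactorial_affine hε p y
  choose h hh using exists_shiftedFactorial_affine hε p z
  let w (k : ℕ) : R := p ^ k * Ring.inverse (shiftedFactorial p p k) ^ 3
  refine ⟨truncatedSeries p n x y z,
    ∑ k ∈ range n, ε * f k * shiftedFactorial y p k * shiftedFactorial z p k * w k,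
    ∑ k ∈ range n, shiftedFactorial x p k * (ε * g k) * shiftedFactorial z p k * w k,
    ∑ k ∈ range n, shiftedFactorial x p k * shiftedFactorial y p k * (ε * h k) * w k,
    fun s t u => ?_⟩
  simp only [truncatedSeries, mul_sum, ← sum_add_distrib]
  refine sum_congr rfl fun k _ => ?_
  rw [hf, hg, hh]
  simp only [w]
  linear_combination (p ^ k * Ring.inverse (shiftedFactorial p p k) ^ 3) *
    (s * t * f k * g k * shiftedFactorial z p k + s * u * f k * h k * shiftedFactorial y p k
      + t * u * g k * h k * shiftedFactorial x p k + s * t * u * ε * f k * g k * h k) * hε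

theorem one_add_pow_of_sq_eq_zero {ε : R} (hε : ε ^ 2 = 0) (m : ℕ) :
    (1 + ε) ^ m = 1 + m * ε := by
  induction m with
  | zero => simp
  | succ m ih =>
    rw [pow_succ, ih]
    push_cast
    linear_combination (m : R) * hε

/-- The first-order expansion in `q ^ n - 1` vanishes at three points, hence on their affine
span. -/
theorem truncatedSeries_eq_zero_of_sq_eq_zero [Algebra ℚ R] {q x y : R} {n N₁ N₂ a₁ a₂ m₁ m₂ : ℕ}
    (hε : (q ^ n - 1) ^ 2 = 0) (hq : ∀ k, 0 < k → k < n → IsUnit (1 - (q ^ 9) ^ k))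
    (hx : x * q ^ 2 = 1) (hy : y * q ^ 5 = 1)
    (hN₁ : 9 * N₁ = a₁ * n + 2) (hN₂ : 9 * N₂ = a₂ * n + 5) (ha : 2 * a₁ + a₂ = 18)
    (hm₁ : N₁ + m₁ + 1 = n) (hm₂ : N₂ + m₂ + 1 = n) (h₁₁ : m₁ + m₁ < N₂) (h₁₂ : m₁ + m₂ < N₁) :
    truncatedSeries (q ^ 9) n x x y = 0 := by
  set ε := q ^ n - 1 with hεdef
  have hqn : q ^ n = 1 + ε := by rw [hεdef]; ring
  have hqpow (m : ℕ) : q ^ (m * n) = 1 + m * ε := by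
    rw [mul_comm, pow_mul, hqn, one_add_pow_of_sq_eq_zero hε]
  obtain ⟨r, hr⟩ : ∃ r, q * r = 1 :=
    ⟨x * q, by linear_combination hx⟩
  set p := q ^ 9 with hpdef
  have hpr (N : ℕ) : (r ^ 9) ^ N * p ^ N = 1 := by
    rw [hpdef, ← mul_pow, ← mul_pow, mul_comm r, hr, one_pow, one_pow]
  have hpn : p ^ n = 1 + 9 * ε := by
    rw [hpdef, ← pow_mul, hqpow]; norm_num
  have hshift {N m : ℕ} (h : N + m + 1 = n) : (r ^ 9) ^ N * (1 + 9 * ε) = p ^ (m + 1) := by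
    rw [← hpn, ← h, add_assoc, pow_add, ← mul_assoc, hpr, one_mul]
  have hbase {N a b : ℕ} {w : R} (hw : w * q ^ b = 1) (h : 9 * N = a * n + b) :
      (r ^ 9) ^ N * (1 + a * ε) = w := by
    have h' : p ^ N = q ^ (a * n) * q ^ b := by rw [hpdef, ← pow_mul, h, pow_add]
    have := hpr N
    rw [h'] at this
    rw [← hqpow]
    linear_combination w * this - (r ^ 9) ^ N * q ^ (a * n) * hw
  set X := (r ^ 9) ^ N₁
  set Y := (r ^ 9) ^ N₂
  obtain ⟨A, B, C, D, hF⟩ := exists_truncatedSeries_affine hε p n X X Y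
  have hF₁ := hF 9 9 0
  have hF₂ := hF 9 0 9
  have hF₃ := hF 0 9 9
  have hF₄ := hF a₁ a₁ a₂
  rw [hshift hm₁, zero_mul, add_zero, mul_one, ← truncatedSeries_rotate,
    truncatedSeries_eq_zero hq (hpr N₂) (by omega) (by omega) (by omega) (by omega)] at hF₁
  rw [hshift hm₁, hshift hm₂, zero_mul, add_zero, mul_one, ← truncatedSeries_swap_left,
    truncatedSeries_eq_zero hq (hpr N₁) (by omega) (by omega) (by omega) (by omega)] at hF₂
  rw [hshift hm₁, hshift hm₂, zero_mul, add_zero, mul_one,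
    truncatedSeries_eq_zero hq (hpr N₁) (by omega) (by omega) (by omega) (by omega)] at hF₃
  rw [hbase hx hN₁, hbase hy hN₂] at hF₄
  have ha' : 2 * (a₁ : R) + a₂ = 18 := by exact_mod_cast congrArg (Nat.cast (R := R)) ha
  have h9 : (9 : R) * truncatedSeries p n x x y = 0 := by
    rw [hF₄]
    linear_combination (-(9 - (a₂ : R))) * hF₁ - (9 - (a₁ : R)) * hF₂ - (9 - (a₁ : R)) * hF₃
      + (A + 9 * B + 9 * C + 9 * D) * ha'
  have hunit : IsUnit (9 : R) := by
    simpa only [map_ofNat] using (IsUnit.mk0 (9 : ℚ) (by norm_num)).map (algebraMap ℚ R)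
  exact hunit.mul_right_eq_zero.1 h9

end CommRing

section Reduction

variable (P : ℚ[X])

/-- The pairs `(A, r)` such that the rational function `A` has a denominator invertible modulo `P`
and reduces to `r` modulo `P`. -/
def reductionGraph : Subring (RatFunc ℚ × AdjoinRoot P) where
  carrier := {z | ∃ a b : ℚ[X], b ≠ 0 ∧ IsUnit (AdjoinRoot.mk P b) ∧
    z.1 * algebraMap ℚ[X] (RatFunc ℚ) b = algebraMap ℚ[X] (RatFunc ℚ) a ∧
    AdjoinRoot.mk P a = z.2 * AdjoinRoot.mk P b}
  zero_mem' := ⟨0, 1, by simp⟩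
  one_mem' := ⟨1, 1, by simp⟩
  add_mem' := by
    rintro z w ⟨a, b, hb, hu, h₁, h₂⟩ ⟨a', b', hb', hu', h₁', h₂'⟩
    refine ⟨a * b' + a' * b, b * b', mul_ne_zero hb hb', by simpa using ⟨hu, hu'⟩, ?_, ?_⟩
    · simp only [map_add, map_mul, Prod.fst_add, ← h₁, ← h₁']
      ring
    · simp only [map_add, map_mul, Prod.snd_add, h₂, h₂']
      ring
  mul_mem' := by
    rintro z w ⟨a, b, hb, hu, h₁, h₂⟩ ⟨a', b', hb', hu', h₁', h₂'⟩
    refine ⟨a * a', b * b', mul_ne_zero hb hb', by simpa using ⟨hu, hu'⟩, ?_, ?_⟩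
    · simp only [map_mul, Prod.fst_mul, ← h₁, ← h₁']
      ring
    · simp only [map_mul, Prod.snd_mul, h₂, h₂']
      ring
  neg_mem' := by
    rintro z ⟨a, b, hb, hu, h₁, h₂⟩
    exact ⟨-a, b, hb, hu, by simp [h₁], by simp [h₂]⟩

variable {P}

theorem isUnit_mk_iff_isCoprime {a : ℚ[X]} : IsUnit (AdjoinRoot.mk P a) ↔ IsCoprime a P := by
  constructor
  · intro h
    obtain ⟨u, hu⟩ := h.exists_left_inv
    obtain ⟨u, rfl⟩ := AdjoinRoot.mk_surjective u
    rw [← map_mul, ← map_one (AdjoinRoot.mk P), AdjoinRoot.mk_eq_mk] at hu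
    obtain ⟨v, hv⟩ := hu
    exact ⟨u, -v, by linear_combination hv⟩
  · rintro ⟨u, v, h⟩
    refine IsUnit.of_mul_eq_one (AdjoinRoot.mk P u) ?_
    have := congrArg (AdjoinRoot.mk P) h
    simpa [mul_comm] using this

theorem congrZero_of_mem_reductionGraph {A : RatFunc ℚ} (h : (A, 0) ∈ reductionGraph P) :
    CongrZero A P := by
  obtain ⟨a, b, hb, hu, h₁, h₂⟩ := h
  rw [zero_mul, AdjoinRoot.mk_eq_zero] at h₂
  obtain ⟨c, rfl⟩ := h₂
  have hb' : algebraMap ℚ[X] (RatFunc ℚ) b ≠ 0 := RatFunc.algebraMap_ne_zero hb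
  refine ⟨algebraMap _ _ c / algebraMap _ _ b, ?_,
    (isUnit_mk_iff_isCoprime.1 hu).of_isCoprime_of_dvd_left (RatFunc.denom_div_dvd c b)⟩
  rw [map_mul] at h₁
  field_simp
  exact h₁

theorem X_mem_reductionGraph : (RatFunc.X, AdjoinRoot.root P) ∈ reductionGraph P :=
  ⟨Polynomial.X, 1, by simp⟩

theorem pow_mem_reductionGraph {A : RatFunc ℚ} {r : AdjoinRoot P} (h : (A, r) ∈ reductionGraph P)
    (k : ℕ) : (A ^ k, r ^ k) ∈ reductionGraph P :=
  pow_mem h k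

theorem inv_mem_reductionGraph (hP : ¬ IsUnit P) {A : RatFunc ℚ} {r s : AdjoinRoot P}
    (h : (A, r) ∈ reductionGraph P) (hrs : r * s = 1) : (A⁻¹, s) ∈ reductionGraph P := by
  obtain ⟨a, b, hb, hu, h₁, h₂⟩ := h
  dsimp only at h₁ h₂
  have hua : IsUnit (AdjoinRoot.mk P a) := h₂ ▸ (IsUnit.of_mul_eq_one _ hrs).mul hu
  have ha : a ≠ 0 := by
    rintro rfl
    exact hP (isCoprime_zero_left.1 (isUnit_mk_iff_isCoprime.1 hua))
  have hA : A ≠ 0 := by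
    rintro rfl
    rw [zero_mul] at h₁
    exact RatFunc.algebraMap_ne_zero ha h₁.symm
  refine ⟨b, a, ha, hua, ?_, ?_⟩
  · rw [← h₁, inv_mul_cancel_left₀ hA]
  · rw [h₂]
    linear_combination (-AdjoinRoot.mk P b) * hrs

theorem qPoch_mem_reductionGraph {x q : RatFunc ℚ} {x' q' : AdjoinRoot P}
    (hx : (x, x') ∈ reductionGraph P) (hq : (q, q') ∈ reductionGraph P) (k : ℕ) :
    (qPoch x q k, shiftedFactorial x' q' k) ∈ reductionGraph P := by
  have := prod_mem (S := reductionGraph P) (t := range k)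
    (f := fun j => (1 : RatFunc ℚ × AdjoinRoot P) - (x, x') * (q, q') ^ j)
    fun j _ => sub_mem (one_mem _) (mul_mem hx (pow_mem hq j))
  convert this using 1
  ext <;> simp [qPoch, shiftedFactorial, Prod.fst_prod, Prod.snd_prod]

end Reduction

theorem isCoprime_one_sub_X_pow_cyclotomic {n j : ℕ} (hj : 0 < j) (h : ¬ n ∣ j) :
    IsCoprime (1 - Polynomial.X ^ j) (cyclotomic n ℚ) := by
  rw [← neg_sub, ← prod_cyclotomic_eq_X_pow_sub_one hj, IsCoprime.neg_left_iff]
  refine IsCoprime.prod_left fun d hd => cyclotomic.isCoprime_rat ?_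
  rintro rfl
  exact h (Nat.dvd_of_mem_divisors hd)

theorem stmt16 (n : ℕ) (hn : 0 < n) (hn9 : 9 < n) (hmod : n % 9 = 2 ∨ n % 9 = 5) :
    CongrZero
      (∑ k ∈ Finset.range n,
        qPoch ((RatFunc.X : RatFunc ℚ) ^ ((-2) : ℤ)) (RatFunc.X ^ 9) k
            * qPoch ((RatFunc.X : RatFunc ℚ) ^ ((-2) : ℤ)) (RatFunc.X ^ 9) k
            * qPoch ((RatFunc.X : RatFunc ℚ) ^ ((-5) : ℤ)) (RatFunc.X ^ 9) k
            * RatFunc.X ^ (9 * k)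
          / (qPoch ((RatFunc.X : RatFunc ℚ) ^ 9) (RatFunc.X ^ 9) k) ^ 3)
      ((Polynomial.cyclotomic n ℚ) ^ 2) := by
  set P := cyclotomic n ℚ ^ 2 with hPdef
  set q := AdjoinRoot.root P with hqdef
  have hP : ¬ IsUnit P := by
    rw [hPdef, isUnit_pow_iff two_ne_zero]
    exact (cyclotomic.irreducible_rat hn).not_isUnit
  have hq : ∀ k, 0 < k → k < n → IsUnit (1 - (q ^ 9) ^ k) := by
    intro k hk hkn
    have hcop : n.Coprime 9 := by
      rw [show 9 = 3 ^ 2 by norm_num, Nat.coprime_pow_right_iff two_pos, Nat.coprime_comm,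
        Nat.Prime.coprime_iff_not_dvd Nat.prime_three]
      omega
    have hndvd : ¬ n ∣ 9 * k := fun h =>
      absurd (Nat.le_of_dvd hk (hcop.dvd_of_dvd_mul_left h)) (by omega)
    have := isUnit_mk_iff_isCoprime.2
      ((isCoprime_one_sub_X_pow_cyclotomic (by omega) hndvd).pow_right (n := 2))
    simpa [pow_mul] using this
  have hε : (q ^ n - 1) ^ 2 = 0 := by
    have : AdjoinRoot.mk P ((Polynomial.X ^ n - 1) ^ 2) = 0 :=
      AdjoinRoot.mk_eq_zero.2 (pow_dvd_pow_of_dvd (cyclotomic.dvd_X_pow_sub_one n ℚ) 2)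
    simpa using this
  obtain ⟨r, hr⟩ : ∃ r, q * r = 1 := by
    refine ⟨q ^ (n - 1) * (2 - q ^ n), ?_⟩
    have : q ^ n = q * q ^ (n - 1) := by rw [← pow_succ', Nat.sub_add_cancel hn]
    rw [this] at hε ⊢
    linear_combination -hε
  have hpow (k : ℕ) : q ^ k * r ^ k = 1 := by rw [← mul_pow, hr, one_pow]
  have hzero : truncatedSeries (q ^ 9) n (r ^ 2) (r ^ 2) (r ^ 5) = 0 := by
    have h2 : r ^ 2 * q ^ 2 = 1 := by rw [mul_comm, hpow]
    have h5 : r ^ 5 * q ^ 5 = 1 := by rw [mul_comm, hpow]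
    obtain ⟨s, rfl | rfl⟩ : ∃ s, n = 9 * s + 2 ∨ n = 9 * s + 5 := ⟨n / 9, by omega⟩
    · exact truncatedSeries_eq_zero_of_sq_eq_zero (N₁ := 8 * s + 2) (N₂ := 2 * s + 1) (a₁ := 8)
        (a₂ := 2) (m₁ := s - 1) (m₂ := 7 * s) hε hq h2 h5 (by ring) (by ring) (by norm_num)
        (by omega) (by omega) (by omega) (by omega)
    · exact truncatedSeries_eq_zero_of_sq_eq_zero (N₁ := 5 * s + 3) (N₂ := 8 * s + 5) (a₁ := 5)
        (a₂ := 8) (m₁ := 4 * s + 1) (m₂ := s - 1) hε hq h2 h5 (by ring) (by ring) (by norm_num)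
        (by omega) (by omega) (by omega) (by omega)
  apply congrZero_of_mem_reductionGraph
  rw [← hzero]
  have hX : (RatFunc.X, q) ∈ reductionGraph P := X_mem_reductionGraph
  have hX9 := pow_mem_reductionGraph hX 9
  have hX_neg (m : ℕ) : ((RatFunc.X : RatFunc ℚ) ^ (-(m : ℤ)), r ^ m) ∈ reductionGraph P := by
    rw [zpow_neg, zpow_natCast]
    exact inv_mem_reductionGraph hP (pow_mem_reductionGraph hX m) (hpow m)
  have hterm : ∀ k ∈ range n, _ ∈ reductionGraph P := fun k hk =>
    mul_mem (mul_mem (mul_mem (mul_mem (qPoch_mem_reductionGraph (hX_neg 2) hX9 k)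
      (qPoch_mem_reductionGraph (hX_neg 2) hX9 k)) (qPoch_mem_reductionGraph (hX_neg 5) hX9 k))
      (pow_mem hX9 k)) (pow_mem (inv_mem_reductionGraph hP (qPoch_mem_reductionGraph hX9 hX9 k)
        (Ring.mul_inverse_cancel _ (isUnit_shiftedFactorial_self hq (mem_range.1 hk)))) 3)
  convert sum_mem hterm using 1
  ext
  · simp [Prod.fst_sum, div_eq_mul_inv, pow_mul]
  · simp [Prod.snd_sum, truncatedSeries]
end
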